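/- Under the hypotheses of the Ehrenfest approximation lemma — V : ℝ^d → (n×n complex Hermitian matrices) smooth; λ₀, Ψ₀ a smooth simple eigenvalue/unit eigenvector branch on an open set O with spectral gap |λ_k(Y) − λ₀(Y)| > δ for all other eigenvalues λ_k and sup_{Y∈O} ‖∇Ψ₀(Y)‖ < δ⁻¹; for each M ≥ 1, (X^M, ψ^M) a solution on [0,T] of the translated Ehrenfest dynamics i ψ̇_t = M^{1/2}(V(X_t) − λ₀(X_t) I) ψ_t, Ẍ_t = −∇λ₀(X_t) − ⟨ψ_t, ∇(V − λ₀ I)(X_t) ψ_t⟩/⟨ψ_t, ψ_t⟩ with X^M_t in a fixed compact D ⊆ O and |Ẋ^M_t| ≤ K uniformly in M; ‖ψ^M_0‖ = 1 and ψ^⊥(0) = 0 — the excitation probability p_E(t) := ‖ψ^⊥(t)‖² / ‖ψ^M_t‖², where ψ^⊥(t) := ψ^M_t − ⟨Ψ₀(X^M_t), ψ^M_t⟩ Ψ₀(X^M_t), satisfies: there exists a constant C > 0 independent of M such that p_E(t) ≤ C M^{−1} for all M ≥ 1 and t ∈ [0,T]. -/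

import Mathlib

open scoped InnerProductSpace

attribute [local instance] Matrix.normedAddCommGroup Matrix.normedSpace

theorem ode_core {F : Type*} [NormedAddCommGroup F] [InnerProductSpace ℂ F]
    (T s B : ℝ) (hT : 0 < T) (hs : 1 ≤ s) (hB : 0 ≤ B)
    (φ φ' w w' ψ ψ' : ℝ → F) (H : ℝ → F →ₗ[ℂ] F)
    (hH : ∀ t ∈ Set.Icc (0:ℝ) T, (H t).IsSymmetric)
    (hφ : ∀ t ∈ Set.Icc (0:ℝ) T, HasDerivAt φ (φ' t) t)
    (hw : ∀ t ∈ Set.Icc (0:ℝ) T, HasDerivAt w (w' t) t)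
    (hψ : ∀ t ∈ Set.Icc (0:ℝ) T, HasDerivAt ψ (ψ' t) t)
    (hφ1 : ∀ t ∈ Set.Icc (0:ℝ) T, ‖φ t‖ = 1)
    (hφ'B : ∀ t ∈ Set.Icc (0:ℝ) T, ‖φ' t‖ ≤ B)
    (hwB : ∀ t ∈ Set.Icc (0:ℝ) T, ‖w t‖ ≤ B)
    (hw'B : ∀ t ∈ Set.Icc (0:ℝ) T, ‖w' t‖ ≤ B)
    (hHφ : ∀ t ∈ Set.Icc (0:ℝ) T, H t (φ t) = 0)
    (hφw : ∀ t ∈ Set.Icc (0:ℝ) T, ⟪φ t, w t⟫_ℂ = 0)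
    (hHw : ∀ t ∈ Set.Icc (0:ℝ) T, H t (w t) = φ' t - ⟪φ t, φ' t⟫_ℂ • φ t)
    (hwave : ∀ t ∈ Set.Icc (0:ℝ) T, Complex.I • ψ' t = (s : ℂ) • H t (ψ t))
    (hψ0 : ‖ψ 0‖ = 1) (hinit : ψ 0 - ⟪φ 0, ψ 0⟫_ℂ • φ 0 = 0) :
    ∀ t ∈ Set.Icc (0:ℝ) T, ‖ψ t‖ = 1 ∧
      ‖ψ t - ⟪φ t, ψ t⟫_ℂ • φ t‖ ^ 2 ≤
        (2 * ((B ^ 2 + (B ^ 2 + B) ^ 2) * Real.exp T) + 2 * B ^ 2) / s ^ 2 := by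
  have hs0 : 0 < s := by linarith
  let _ : InnerProductSpace ℝ F := InnerProductSpace.rclikeToReal ℂ F
  have hre : ∀ x y : F, ⟪x, y⟫_ℝ = (⟪x, y⟫_ℂ).re := fun x y => rfl
  have h0 : (0:ℝ) ∈ Set.Icc (0:ℝ) T := ⟨le_rfl, hT.le⟩
  have hψ' : ∀ t ∈ Set.Icc (0:ℝ) T, ψ' t = (-Complex.I * s) • H t (ψ t) := by
    intro t ht
    rw [mul_smul, ← hwave t ht, smul_smul]; simp
  have hsymre : ∀ t ∈ Set.Icc (0:ℝ) T, ∀ x, (⟪x, (-Complex.I * s) • H t x⟫_ℂ).re = 0 := by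
    intro t ht x
    have him : (⟪x, H t x⟫_ℂ).im = 0 := by
      have := (hH t ht).im_inner_self_apply x
      simpa using this
    rw [inner_smul_right]
    simp [Complex.mul_re, him]
  have hnorm : ∀ t ∈ Set.Icc (0:ℝ) T, ‖ψ t‖ = 1 := by
    intro t ht
    have h1 : ∀ t ∈ Set.Icc (0:ℝ) T, HasDerivAt (fun t => ‖ψ t‖ ^ 2) 0 t := by
      intro t ht
      have := (hψ t ht).norm_sq
      rw [hre, hψ' t ht, hsymre t ht] at this
      simpa using this
    have h2 := constant_of_has_deriv_right_zero (f := fun t => ‖ψ t‖ ^ 2) (a := 0) (b := T)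
      (fun t ht => (h1 t ht).continuousAt.continuousWithinAt)
      (fun t ht => (h1 t ⟨ht.1, ht.2.le⟩).hasDerivWithinAt) t ht
    simp only [hψ0] at h2
    have := norm_nonneg (ψ t)
    nlinarith
  set a : ℝ → ℂ := fun t => ⟪φ t, ψ t⟫_ℂ with ha
  have ha' : ∀ t ∈ Set.Icc (0:ℝ) T, HasDerivAt a ⟪φ' t, ψ t⟫_ℂ t := by
    intro t ht
    have := (hφ t ht).inner ℂ (hψ t ht)
    have h3 : ⟪φ t, ψ' t⟫_ℂ = 0 := by
      rw [hψ' t ht, inner_smul_right, ← (hH t ht) (φ t) (ψ t), hHφ t ht]; simp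
    rw [h3, zero_add] at this
    exact this
  have haB : ∀ t ∈ Set.Icc (0:ℝ) T, ‖a t‖ ≤ 1 := by
    intro t ht
    have := norm_inner_le_norm (𝕜 := ℂ) (φ t) (ψ t)
    rwa [hφ1 t ht, hnorm t ht, one_mul] at this
  have ha'B : ∀ t ∈ Set.Icc (0:ℝ) T, ‖⟪φ' t, ψ t⟫_ℂ‖ ≤ B := by
    intro t ht
    have := norm_inner_le_norm (𝕜 := ℂ) (φ' t) (ψ t)
    rw [hnorm t ht, mul_one] at this
    exact this.trans (hφ'B t ht)
  set c : ℂ := Complex.I / s with hc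
  have hcn : ‖c‖ = 1 / s := by simp [hc, abs_of_pos hs0]
  set χ : ℝ → F := fun t => ψ t - a t • φ t - c • (a t • w t) with hχ
  set r : ℝ → F := fun t => c • (⟪φ' t, ψ t⟫_ℂ • w t + a t • w' t) with hr
  have hχd : ∀ t ∈ Set.Icc (0:ℝ) T, HasDerivAt χ
      ((-Complex.I * s) • H t (χ t) - (⟪φ' t, ψ t⟫_ℂ + a t * ⟪φ t, φ' t⟫_ℂ) • φ t - r t) t := by
    intro t ht
    have h1 := ((hψ t ht).sub ((ha' t ht).smul (hφ t ht))).sub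
      (((ha' t ht).smul (hw t ht)).const_smul c)
    refine h1.congr_deriv ?_
    symm
    have hsc : Complex.I * s * c = -1 := by
      rw [hc]
      have : (s:ℂ) ≠ 0 := by exact_mod_cast hs0.ne'
      field_simp
      simp
    simp only [hχ, hr, map_sub, map_smul, hHφ t ht, hHw t ht, hψ' t ht, smul_zero, sub_zero]
    rw [smul_sub (-Complex.I * (s:ℂ)), smul_smul (-Complex.I * (s:ℂ)) c, neg_mul, neg_mul, hsc]
    module
  have hχφ : ∀ t ∈ Set.Icc (0:ℝ) T, ⟪χ t, φ t⟫_ℂ = 0 := by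
    intro t ht
    have hwφ : ⟪w t, φ t⟫_ℂ = 0 := by rw [← inner_conj_symm, hφw t ht]; simp
    have hφφ : ⟪φ t, φ t⟫_ℂ = 1 := by
      rw [inner_self_eq_norm_sq_to_K, hφ1 t ht]; simp
    simp only [hχ, inner_sub_left, inner_smul_left, hwφ, hφφ, ha]
    simp
  have hrB : ∀ t ∈ Set.Icc (0:ℝ) T, ‖r t‖ ≤ (B ^ 2 + B) / s := by
    intro t ht
    simp only [hr, norm_smul, hcn]
    have h1 : ‖⟪φ' t, ψ t⟫_ℂ • w t + a t • w' t‖ ≤ B * B + 1 * B := by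
      refine (norm_add_le _ _).trans ?_
      rw [norm_smul, norm_smul]
      gcongr
      exacts [ha'B t ht, hwB t ht, haB t ht, hw'B t ht]
    calc 1 / s * _ ≤ 1 / s * (B * B + 1 * B) := by gcongr
      _ = _ := by ring
  have hcw : ∀ t ∈ Set.Icc (0:ℝ) T, ‖c • (a t • w t)‖ ≤ B / s := by
    intro t ht
    rw [norm_smul, norm_smul, hcn]
    calc 1 / s * (‖a t‖ * ‖w t‖) ≤ 1 / s * (1 * B) := by
          gcongr
          exacts [haB t ht, hwB t ht]
      _ = _ := by ring
  have hg : ∀ t ∈ Set.Icc (0:ℝ) T, HasDerivAt (fun t => ‖χ t‖ ^ 2) (2 * ⟪χ t, - r t⟫_ℝ) t := by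
    intro t ht
    have h1 := (hχd t ht).norm_sq
    convert h1 using 2
    rw [hre, hre, inner_sub_right, inner_sub_right, Complex.sub_re, Complex.sub_re,
      hsymre t ht, inner_smul_right, hχφ t ht, inner_neg_right]
    simp
  have hgron := norm_le_gronwallBound_of_norm_deriv_right_le (f := fun t => ‖χ t‖ ^ 2)
    (f' := fun t => 2 * ⟪χ t, - r t⟫_ℝ) (a := 0) (b := T) (δ := (B / s) ^ 2) (K := 1)
    (ε := ((B ^ 2 + B) / s) ^ 2)
    (fun t ht => (hg t ht).continuousAt.continuousWithinAt)
    (fun t ht => (hg t ⟨ht.1, ht.2.le⟩).hasDerivWithinAt)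
    (by
      have : χ 0 = - (c • (a 0 • w 0)) := by
        simp only [hχ, ha]; rw [hinit, zero_sub]
      rw [this, norm_neg, Real.norm_of_nonneg (by positivity)]
      have := hcw 0 h0
      gcongr)
    (by
      intro t ht
      have ht' : t ∈ Set.Icc 0 T := ⟨ht.1, ht.2.le⟩
      have h1 : |⟪χ t, - r t⟫_ℝ| ≤ ‖χ t‖ * ‖r t‖ := by
        simpa using abs_real_inner_le_norm (χ t) (- r t)
      have h2 : ‖r t‖ ^ 2 ≤ ((B ^ 2 + B) / s) ^ 2 := by
        have := hrB t ht'
        gcongr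
      rw [norm_mul, Real.norm_eq_abs, Real.norm_eq_abs, Real.norm_of_nonneg (by positivity)]
      simp only [abs_two]
      nlinarith [sq_nonneg (‖χ t‖ - ‖r t‖)])
  intro t ht
  refine ⟨hnorm t ht, ?_⟩
  have h1 := hgron t ht
  rw [gronwallBound_of_K_ne_0 one_ne_zero, Real.norm_of_nonneg (by positivity)] at h1
  simp only [sub_zero, one_mul, div_one] at h1
  have h2 : ψ t - a t • φ t = χ t + c • (a t • w t) := by simp [hχ]
  have h3 : ‖ψ t - a t • φ t‖ ≤ ‖χ t‖ + B / s := by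
    rw [h2]; exact (norm_add_le _ _).trans (by gcongr; exact hcw t ht)
  have h4 : Real.exp t ≤ Real.exp T := Real.exp_le_exp.2 ht.2
  have h5 : ‖χ t‖ ^ 2 ≤ ((B / s) ^ 2 + ((B ^ 2 + B) / s) ^ 2) * Real.exp T := by
    have e1 : (B / s) ^ 2 * Real.exp t ≤ (B / s) ^ 2 * Real.exp T := by gcongr
    have e2 : ((B ^ 2 + B) / s) ^ 2 * Real.exp t ≤ ((B ^ 2 + B) / s) ^ 2 * Real.exp T := by gcongr
    have e3 : 0 ≤ ((B ^ 2 + B) / s) ^ 2 := by positivity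
    nlinarith
  calc ‖ψ t - a t • φ t‖ ^ 2 ≤ (‖χ t‖ + B / s) ^ 2 := by gcongr
    _ ≤ 2 * ‖χ t‖ ^ 2 + 2 * (B / s) ^ 2 := by nlinarith [sq_nonneg (‖χ t‖ - B / s)]
    _ ≤ 2 * (((B / s) ^ 2 + ((B ^ 2 + B) / s) ^ 2) * Real.exp T) + 2 * (B / s) ^ 2 := by gcongr
    _ = _ := by field_simp

theorem corrector_exists {d n : ℕ}
    (O : Set (EuclideanSpace ℝ (Fin d))) (hO : IsOpen O)
    (H : EuclideanSpace ℝ (Fin d) → EuclideanSpace ℂ (Fin n) →ₗ[ℂ] EuclideanSpace ℂ (Fin n))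
    (Φ : EuclideanSpace ℝ (Fin d) → EuclideanSpace ℂ (Fin n))
    (hHs : ∀ v, ContDiffOn ℝ (⊤ : ℕ∞) (fun x => H x v) O)
    (hΦs : ContDiffOn ℝ (⊤ : ℕ∞) Φ O)
    (hΦ1 : ∀ x ∈ O, ‖Φ x‖ = 1)
    (hsym : ∀ x ∈ O, (H x).IsSymmetric)
    (hHΦ : ∀ x ∈ O, H x (Φ x) = 0)
    (hker : ∀ x ∈ O, ∀ v, H x v = 0 → ∃ c : ℂ, c • Φ x = v) :
    ∃ W : EuclideanSpace ℝ (Fin d) → EuclideanSpace ℝ (Fin d) →L[ℝ] EuclideanSpace ℂ (Fin n),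
      ContDiffOn ℝ 1 W O ∧ ∀ x ∈ O, ∀ v, ⟪Φ x, W x v⟫_ℂ = 0 ∧
        H x (W x v) = fderiv ℝ Φ x v - ⟪Φ x, fderiv ℝ Φ x v⟫_ℂ • Φ x := by
  let P : EuclideanSpace ℝ (Fin d) → EuclideanSpace ℂ (Fin n) →ₗ[ℂ] EuclideanSpace ℂ (Fin n) :=
    fun x => (innerₛₗ ℂ (Φ x)).smulRight (Φ x)
  have hP : ∀ x v, P x v = ⟪Φ x, v⟫_ℂ • Φ x := fun x v => rfl
  let Pr : EuclideanSpace ℝ (Fin d) → EuclideanSpace ℂ (Fin n) →L[ℝ] EuclideanSpace ℂ (Fin n) :=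
    fun x => ((P x).restrictScalars ℝ).toContinuousLinearMap
  have hPr : ∀ x v, Pr x v = ⟪Φ x, v⟫_ℂ • Φ x := fun x v => rfl
  let Hr : EuclideanSpace ℝ (Fin d) → EuclideanSpace ℂ (Fin n) →L[ℝ] EuclideanSpace ℂ (Fin n) :=
    fun x => ((H x).restrictScalars ℝ).toContinuousLinearMap
  have hHr : ∀ x v, Hr x v = H x v := fun x v => rfl
  let A := fun x => Hr x + Pr x
  have hA : ∀ x v, A x v = H x v + ⟪Φ x, v⟫_ℂ • Φ x := fun x v => rfl
  have hPs : ContDiffOn ℝ (⊤ : ℕ∞) Pr O := by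
    rw [contDiffOn_clm_apply]
    intro v
    simp only [hPr]
    exact (hΦs.inner ℂ contDiffOn_const).smul hΦs
  have hHrs : ContDiffOn ℝ (⊤ : ℕ∞) Hr O := by
    rw [contDiffOn_clm_apply]
    exact hHs
  have hAs : ContDiffOn ℝ (⊤ : ℕ∞) A O := hHrs.add hPs
  have hφφ : ∀ x ∈ O, ⟪Φ x, Φ x⟫_ℂ = 1 := by
    intro x hx
    rw [inner_self_eq_norm_sq_to_K, hΦ1 x hx]; simp
  have hφA : ∀ x ∈ O, ∀ v, ⟪Φ x, A x v⟫_ℂ = ⟪Φ x, v⟫_ℂ := by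
    intro x hx v
    rw [hA, inner_add_right, ← hsym x hx, hHΦ x hx, inner_smul_right, hφφ x hx]; simp
  have hU : ∀ x ∈ O, IsUnit (A x) := by
    intro x hx
    have hinj : Function.Injective (A x) := by
      rw [injective_iff_map_eq_zero]
      intro v hv
      have h1 : ⟪Φ x, v⟫_ℂ = 0 := by rw [← hφA x hx, hv]; simp
      have h2 : H x v = 0 := by
        have := hA x v
        rw [hv, h1] at this
        simpa using this.symm
      obtain ⟨c, rfl⟩ := hker x hx v h2
      rw [inner_smul_right, hφφ x hx, mul_one] at h1
      simp [h1]
    rw [ContinuousLinearMap.isUnit_iff_bijective]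
    exact ⟨hinj, (LinearMap.injective_iff_surjective (f := (A x).toLinearMap)).1 hinj⟩
  have hG : ContDiffOn ℝ (⊤ : ℕ∞) (fun x => Ring.inverse (A x)) O := by
    intro x hx
    obtain ⟨u, hu⟩ := hU x hx
    have h1 := contDiffAt_ringInverse ℝ (n := (⊤ : ℕ∞)) u
    rw [hu] at h1
    exact h1.comp_contDiffWithinAt x (hAs x hx)
  have hD : ContDiffOn ℝ 1 (fderiv ℝ Φ) O := hΦs.fderiv_of_isOpen hO (by norm_cast)
  refine ⟨fun x => Ring.inverse (A x) ∘L ((ContinuousLinearMap.id ℝ _ - Pr x) ∘L fderiv ℝ Φ x),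
    (hG.of_le (by norm_cast)).clm_comp
      ((contDiffOn_const.sub (hPs.of_le (by norm_cast))).clm_comp hD), ?_⟩
  intro x hx v
  simp only [ContinuousLinearMap.comp_apply, sub_apply,
    ContinuousLinearMap.id_apply, hPr]
  set z := fderiv ℝ Φ x v
  set y := z - ⟪Φ x, z⟫_ℂ • Φ x with hy
  have h1 : A x (Ring.inverse (A x) y) = y := by
    have := Ring.mul_inverse_cancel (A x) (hU x hx)
    exact congrArg (fun f => f y) this
  have h2 : ⟪Φ x, Ring.inverse (A x) y⟫_ℂ = 0 := by
    rw [← hφA x hx, h1, hy, inner_sub_right, inner_smul_right, hφφ x hx]; simp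
  refine ⟨h2, ?_⟩
  rw [hA, h2] at h1
  simpa using h1

theorem force_bound {d n : ℕ}
    (O D : Set (EuclideanSpace ℝ (Fin d))) (hO : IsOpen O) (hDO : D ⊆ O) (hD : IsCompact D)
    (lam₀ : EuclideanSpace ℝ (Fin d) → ℝ)
    (U : EuclideanSpace ℝ (Fin d) → Matrix (Fin n) (Fin n) ℂ)
    (hlam : ContDiffOn ℝ (⊤ : ℕ∞) lam₀ O) (hU : ContDiffOn ℝ (⊤ : ℕ∞) U O) :
    ∃ B : ℝ, ∀ x ∈ D, ∀ (a : EuclideanSpace ℝ (Fin d)) (p : EuclideanSpace ℂ (Fin n)),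
      (∀ j, a j = -(fderivWithin ℝ lam₀ O x (EuclideanSpace.single j 1))
            - (⟪p, Matrix.toEuclideanLin
                  (fderivWithin ℝ U O x (EuclideanSpace.single j 1)) p⟫_ℂ / ⟪p, p⟫_ℂ).re) →
      ‖a‖ ≤ B := by
  have h1 := (hlam.continuousOn_fderivWithin hO.uniqueDiffOn (by norm_cast)).mono hDO
  have h2 := (hU.continuousOn_fderivWithin hO.uniqueDiffOn (by norm_cast)).mono hDO
  let L : Matrix (Fin n) (Fin n) ℂ →L[ℝ]
      (EuclideanSpace ℂ (Fin n) →L[ℂ] EuclideanSpace ℂ (Fin n)) :=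
    ((LinearMap.toContinuousLinearMap.toLinearMap ∘ₗ
      (Matrix.toEuclideanLin (𝕜 := ℂ) (m := Fin n) (n := Fin n)).toLinearMap).restrictScalars
        ℝ).toContinuousLinearMap
  have hL : ∀ m v, L m v = Matrix.toEuclideanLin m v := fun m v => rfl
  obtain ⟨CL, hCL0, hCL⟩ := L.bound
  obtain ⟨B1, hB1⟩ := hD.exists_bound_of_continuousOn h1
  obtain ⟨B2, hB2⟩ := hD.exists_bound_of_continuousOn h2
  refine ⟨Real.sqrt (∑ _j : Fin d, (B1 + CL * B2) ^ 2), fun x hx a p ha => ?_⟩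
  rw [EuclideanSpace.norm_eq]
  apply Real.sqrt_le_sqrt
  apply Finset.sum_le_sum
  intro j _
  have hj : ‖(EuclideanSpace.single j 1 : EuclideanSpace ℝ (Fin d))‖ = 1 := by simp
  have e1 : ‖fderivWithin ℝ lam₀ O x (EuclideanSpace.single j 1)‖ ≤ B1 := by
    have := (fderivWithin ℝ lam₀ O x).le_opNorm (EuclideanSpace.single j 1)
    rw [hj, mul_one] at this
    exact this.trans (hB1 x hx)
  have e2 : ‖fderivWithin ℝ U O x (EuclideanSpace.single j 1)‖ ≤ B2 := by
    have := (fderivWithin ℝ U O x).le_opNorm (EuclideanSpace.single j 1)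
    rw [hj, mul_one] at this
    exact this.trans (hB2 x hx)
  have hB2' : 0 ≤ B2 := (norm_nonneg _).trans e2
  have e3 : ‖⟪p, Matrix.toEuclideanLin
      (fderivWithin ℝ U O x (EuclideanSpace.single j 1)) p⟫_ℂ / ⟪p, p⟫_ℂ‖ ≤ CL * B2 := by
    rw [norm_div]
    apply div_le_of_le_mul₀ (norm_nonneg _) (by positivity)
    rw [inner_self_eq_norm_sq_to_K, ← hL]
    have f1 := norm_inner_le_norm (𝕜 := ℂ) p
      (L (fderivWithin ℝ U O x (EuclideanSpace.single j 1)) p)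
    have f2 := (L (fderivWithin ℝ U O x (EuclideanSpace.single j 1))).le_opNorm p
    have f3 := hCL (fderivWithin ℝ U O x (EuclideanSpace.single j 1))
    have f4 : ‖((‖p‖ : ℂ)) ^ 2‖ = ‖p‖ ^ 2 := by simp
    refine f1.trans ?_
    calc ‖p‖ * _ ≤ ‖p‖ * (CL * B2 * ‖p‖) := by
          gcongr
          refine f2.trans ?_
          gcongr
          refine f3.trans ?_
          gcongr
      _ = CL * B2 * ‖p‖ ^ 2 := by ring
      _ ≤ _ := le_of_eq (congrArg _ f4.symm)
  have e4 : ‖a j‖ ≤ B1 + CL * B2 := by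
    rw [ha j]
    refine (norm_sub_le _ _).trans ?_
    rw [norm_neg]
    have := (Complex.abs_re_le_norm _).trans e3
    exact add_le_add e1 this
  gcongr

/-- Bound on the excitation probability. Under the spectral gap
condition, for the family (indexed by the mass ratio `M ≥ 1`) of solutions
`(X^M, ψ^M)` of the translated Ehrenfest dynamics on `[0, T]`, staying in a
compact set `D` inside the open set `O` where the smooth simple ground state
eigenpair `(λ₀, Ψ₀)` is defined, with speed bound `K` and with the orthogonal
component vanishing initially and `‖ψ^M_0‖ = 1`, the excitation probability
`p_E(t) = ‖ψ^⊥(t)‖² / ‖ψ^M_t‖²`, where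
`ψ^⊥(t) = ψ^M_t − ⟨Ψ₀(X^M_t), ψ^M_t⟩ Ψ₀(X^M_t)`, satisfies
`p_E(t) ≤ C M^{−1}` with `C` independent of `M`. -/
theorem ehrenfest_excitation_probability_bound
    (n d : ℕ) (hn : 1 ≤ n) (hd : 1 ≤ d)
    (T : ℝ) (hT : 0 < T) (δ : ℝ) (hδ : 0 < δ) (K : ℝ) (hK : 0 < K)
    (V : EuclideanSpace ℝ (Fin d) → Matrix (Fin n) (Fin n) ℂ)
    (hV : ContDiff ℝ (⊤ : ℕ∞) V) (hVherm : ∀ x, (V x).IsHermitian)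
    (O : Set (EuclideanSpace ℝ (Fin d))) (hO : IsOpen O)
    (lam₀ : EuclideanSpace ℝ (Fin d) → ℝ)
    (Ψ₀ : EuclideanSpace ℝ (Fin d) → EuclideanSpace ℂ (Fin n))
    (hlam₀smooth : ContDiffOn ℝ (⊤ : ℕ∞) lam₀ O)
    (hΨ₀smooth : ContDiffOn ℝ (⊤ : ℕ∞) Ψ₀ O)
    (heig : ∀ Y ∈ O, Matrix.toEuclideanLin (V Y) (Ψ₀ Y) = (lam₀ Y : ℂ) • Ψ₀ Y)
    (hΨ₀norm : ∀ Y ∈ O, ‖Ψ₀ Y‖ = 1)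
    (hsimple : ∀ Y ∈ O, Module.finrank ℂ
        (Module.End.eigenspace (Matrix.toEuclideanLin (V Y)) (lam₀ Y : ℂ)) = 1)
    (hgap : ∀ Y ∈ O, ∀ μ : ℂ, Module.End.HasEigenvalue (Matrix.toEuclideanLin (V Y)) μ →
        μ ≠ (lam₀ Y : ℂ) → δ < ‖μ - (lam₀ Y : ℂ)‖)
    (hgrad : ∃ B : ℝ, B < δ⁻¹ ∧ ∀ Y ∈ O, ‖fderivWithin ℝ Ψ₀ O Y‖ ≤ B)
    (D : Set (EuclideanSpace ℝ (Fin d))) (hDO : D ⊆ O) (hD : IsCompact D)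
    (X X' X'' : ℝ → ℝ → EuclideanSpace ℝ (Fin d))
    (ψ ψ' : ℝ → ℝ → EuclideanSpace ℂ (Fin n))
    (hX : ∀ M, 1 ≤ M → ∀ t ∈ Set.Icc (0:ℝ) T, HasDerivAt (X M) (X' M t) t)
    (hX' : ∀ M, 1 ≤ M → ∀ t ∈ Set.Icc (0:ℝ) T, HasDerivAt (X' M) (X'' M t) t)
    (hψ : ∀ M, 1 ≤ M → ∀ t ∈ Set.Icc (0:ℝ) T, HasDerivAt (ψ M) (ψ' M t) t)
    (hXD : ∀ M, 1 ≤ M → ∀ t ∈ Set.Icc (0:ℝ) T, X M t ∈ D)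
    (hspeed : ∀ M, 1 ≤ M → ∀ t ∈ Set.Icc (0:ℝ) T, ‖X' M t‖ ≤ K)
    (hψ0norm : ∀ M, 1 ≤ M → ‖ψ M 0‖ = 1)
    (hforce : ∀ M, 1 ≤ M → ∀ t ∈ Set.Icc (0:ℝ) T, ∀ j : Fin d,
        X'' M t j
          = -(fderivWithin ℝ lam₀ O (X M t) (EuclideanSpace.single j 1))
            - (⟪ψ M t, Matrix.toEuclideanLin
                  (fderivWithin ℝ
                    (fun x => V x - (lam₀ x : ℂ) • (1 : Matrix (Fin n) (Fin n) ℂ))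
                    O (X M t) (EuclideanSpace.single j 1))
                  (ψ M t)⟫_ℂ
              / ⟪ψ M t, ψ M t⟫_ℂ).re)
    (hwave : ∀ M, 1 ≤ M → ∀ t ∈ Set.Icc (0:ℝ) T,
        Complex.I • ψ' M t
          = (Real.sqrt M : ℂ) • Matrix.toEuclideanLin
              (V (X M t) - (lam₀ (X M t) : ℂ) • (1 : Matrix (Fin n) (Fin n) ℂ))
              (ψ M t))
    (hinit : ∀ M, 1 ≤ M →
        ψ M 0 - ⟪Ψ₀ (X M 0), ψ M 0⟫_ℂ • Ψ₀ (X M 0) = 0) :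
    ∃ C : ℝ, 0 < C ∧ ∀ M, 1 ≤ M → ∀ t ∈ Set.Icc (0:ℝ) T,
      ‖ψ M t - ⟪Ψ₀ (X M t), ψ M t⟫_ℂ • Ψ₀ (X M t)‖ ^ 2 / ‖ψ M t‖ ^ 2
        ≤ C / M := by
  set U : EuclideanSpace ℝ (Fin d) → Matrix (Fin n) (Fin n) ℂ :=
    fun x => V x - (lam₀ x : ℂ) • (1 : Matrix (Fin n) (Fin n) ℂ) with hUdef
  set H : EuclideanSpace ℝ (Fin d) → EuclideanSpace ℂ (Fin n) →ₗ[ℂ] EuclideanSpace ℂ (Fin n) :=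
    fun x => Matrix.toEuclideanLin (U x) with hHdef
  have hlamC : ContDiffOn ℝ (⊤ : ℕ∞) (fun x => (lam₀ x : ℂ)) O :=
    Complex.ofRealCLM.contDiff.comp_contDiffOn hlam₀smooth
  have hUs : ContDiffOn ℝ (⊤ : ℕ∞) U O := hV.contDiffOn.sub (hlamC.smul contDiffOn_const)
  have hHs : ∀ v, ContDiffOn ℝ (⊤ : ℕ∞) (fun x => H x v) O := by
    intro v
    exact ((LinearMap.applyₗ (R := ℂ) v ∘ₗ
      (Matrix.toEuclideanLin (𝕜 := ℂ) (m := Fin n) (n := Fin n)).toLinearMap).restrictScalars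
        ℝ).toContinuousLinearMap.contDiff.comp_contDiffOn hUs
  have hHapp : ∀ x v, H x v = Matrix.toEuclideanLin (V x) v - (lam₀ x : ℂ) • v := by
    intro x v
    simp only [hHdef, hUdef, map_sub, map_smul, LinearMap.sub_apply, LinearMap.smul_apply]
    congr 2
    ext i
    simp [Matrix.toEuclideanLin, Matrix.toLpLin_apply]
  have hHΦ : ∀ x ∈ O, H x (Ψ₀ x) = 0 := by
    intro x hx
    rw [hHapp, heig x hx, sub_self]
  have hsym : ∀ x, (H x).IsSymmetric := by
    intro x
    refine Matrix.isHermitian_iff_isSymmetric.1 ?_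
    refine (hVherm x).sub ?_
    ext i j
    by_cases hij : i = j <;> simp [hij, Matrix.one_apply, eq_comm]
  have hker : ∀ x ∈ O, ∀ v, H x v = 0 → ∃ c : ℂ, c • Ψ₀ x = v := by
    intro x hx v hv
    have hne : Ψ₀ x ≠ 0 := by
      intro h
      have := hΨ₀norm x hx
      simp [h] at this
    have h1 : Ψ₀ x ∈ Module.End.eigenspace (Matrix.toEuclideanLin (V x)) (lam₀ x : ℂ) :=
      Module.End.mem_eigenspace_iff.2 (heig x hx)
    have h2 : v ∈ Module.End.eigenspace (Matrix.toEuclideanLin (V x)) (lam₀ x : ℂ) :=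
      Module.End.mem_eigenspace_iff.2 (by rw [hHapp, sub_eq_zero] at hv; exact hv)
    obtain ⟨c, hc⟩ := (finrank_eq_one_iff_of_nonzero' (⟨Ψ₀ x, h1⟩ :
      Module.End.eigenspace (Matrix.toEuclideanLin (V x)) (lam₀ x : ℂ))
      (by simpa using hne)).1 (hsimple x hx) ⟨v, h2⟩
    exact ⟨c, congrArg Subtype.val hc⟩
  obtain ⟨W, hWs, hW⟩ := corrector_exists O hO H Ψ₀ hHs hΨ₀smooth hΨ₀norm
    (fun x _ => hsym x) hHΦ hker
  obtain ⟨BF, hBF⟩ := force_bound O D hO hDO hD lam₀ U hlam₀smooth hUs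
  obtain ⟨B1, hB1⟩ := hD.exists_bound_of_continuousOn
    ((hΨ₀smooth.continuousOn_fderiv_of_isOpen hO (by norm_cast)).mono hDO)
  obtain ⟨B2, hB2⟩ := hD.exists_bound_of_continuousOn (hWs.continuousOn.mono hDO)
  obtain ⟨B3, hB3⟩ := hD.exists_bound_of_continuousOn
    ((hWs.continuousOn_fderiv_of_isOpen hO le_rfl).mono hDO)
  set B : ℝ := |B1| * K + |B2| * K + (|B3| * K * K + |B2| * |BF|) with hBdef
  have hB : 0 ≤ B := by positivity
  refine ⟨(2 * ((B ^ 2 + (B ^ 2 + B) ^ 2) * Real.exp T) + 2 * B ^ 2) + 1, by positivity, ?_⟩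
  intro M hM t ht
  have hM0 : 0 < M := by linarith
  have hΨd : ∀ x ∈ O, HasFDerivAt Ψ₀ (fderiv ℝ Ψ₀ x) x := fun x hx =>
    ((hΨ₀smooth.contDiffAt (hO.mem_nhds hx)).differentiableAt (by simp)).hasFDerivAt
  have hWd : ∀ x ∈ O, HasFDerivAt W (fderiv ℝ W x) x := fun x hx =>
    ((hWs.contDiffAt (hO.mem_nhds hx)).differentiableAt (by simp)).hasFDerivAt
  have hXO : ∀ t ∈ Set.Icc (0:ℝ) T, X M t ∈ O := fun t ht => hDO (hXD M hM t ht)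
  have hX''B : ∀ t ∈ Set.Icc (0:ℝ) T, ‖X'' M t‖ ≤ BF := fun t ht =>
    hBF _ (hXD M hM t ht) _ (ψ M t) (hforce M hM t ht)
  have key := ode_core T (Real.sqrt M) B hT (Real.one_le_sqrt.2 hM) hB
    (fun t => Ψ₀ (X M t)) (fun t => fderiv ℝ Ψ₀ (X M t) (X' M t))
    (fun t => W (X M t) (X' M t))
    (fun t => fderiv ℝ W (X M t) (X' M t) (X' M t) + W (X M t) (X'' M t))
    (ψ M) (ψ' M) (fun t => H (X M t))
    (fun t _ => hsym _)
    (fun t ht => (hΨd _ (hXO t ht)).comp_hasDerivAt t (hX M hM t ht))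
    (fun t ht => ((hWd _ (hXO t ht)).comp_hasDerivAt t (hX M hM t ht)).clm_apply (hX' M hM t ht))
    (hψ M hM)
    (fun t ht => hΨ₀norm _ (hXO t ht))
    (by
      intro t ht
      have e1 : ‖fderiv ℝ Ψ₀ (X M t) (X' M t)‖ ≤ |B1| * K :=
        (ContinuousLinearMap.le_opNorm _ _).trans (mul_le_mul
          ((hB1 _ (hXD M hM t ht)).trans (le_abs_self _)) (hspeed M hM t ht)
          (norm_nonneg _) (abs_nonneg _))
      have e2 : 0 ≤ |B2| * K + (|B3| * K * K + |B2| * |BF|) := by positivity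
      linarith)
    (by
      intro t ht
      have e1 : ‖W (X M t) (X' M t)‖ ≤ |B2| * K :=
        (ContinuousLinearMap.le_opNorm _ _).trans (mul_le_mul
          ((hB2 _ (hXD M hM t ht)).trans (le_abs_self _)) (hspeed M hM t ht)
          (norm_nonneg _) (abs_nonneg _))
      have e2 : 0 ≤ |B1| * K + (|B3| * K * K + |B2| * |BF|) := by positivity
      linarith)
    (by
      intro t ht
      have e1 : ‖W (X M t) (X'' M t)‖ ≤ |B2| * |BF| :=
        (ContinuousLinearMap.le_opNorm _ _).trans (mul_le_mul
          ((hB2 _ (hXD M hM t ht)).trans (le_abs_self _))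
          ((hX''B t ht).trans (le_abs_self _))
          (norm_nonneg _) (abs_nonneg _))
      have e2 : ‖fderiv ℝ W (X M t) (X' M t)‖ ≤ |B3| * K :=
        (ContinuousLinearMap.le_opNorm _ _).trans (mul_le_mul
          ((hB3 _ (hXD M hM t ht)).trans (le_abs_self _)) (hspeed M hM t ht)
          (norm_nonneg _) (abs_nonneg _))
      have e3 : ‖fderiv ℝ W (X M t) (X' M t) (X' M t)‖ ≤ |B3| * K * K :=
        (ContinuousLinearMap.le_opNorm _ _).trans (mul_le_mul
          e2 (hspeed M hM t ht) (norm_nonneg _) (by positivity))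
      have e4 : 0 ≤ |B1| * K + |B2| * K := by positivity
      have e5 := norm_add_le (fderiv ℝ W (X M t) (X' M t) (X' M t)) (W (X M t) (X'' M t))
      linarith)
    (fun t ht => hHΦ _ (hXO t ht))
    (fun t ht => (hW _ (hXO t ht) _).1)
    (fun t ht => (hW _ (hXO t ht) _).2)
    (hwave M hM) (hψ0norm M hM) (hinit M hM) t ht
  obtain ⟨k1, k2⟩ := key
  rw [k1, one_pow, div_one]
  rw [Real.sq_sqrt hM0.le] at k2
  exact k2.trans (div_le_div_of_nonneg_right (by linarith) hM0.le)
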